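/- (Convexity of the group SLOPE penalty) Let λ₁ ≥ λ₂ ≥ ⋯ ≥ λ_p ≥ 0. Then the function G ↦ P_λ([[G]]) = Σ_{j=1}^p λ_j ‖g‖_{(j)}, where ‖g‖_{(j)} denotes the j-th largest Euclidean row norm of G ∈ ℝ^{p×K}, is a convex function on ℝ^{p×K}. -/

import Mathlib

open Matrix

/-- The vector of Euclidean row norms `[[G]]` of a matrix `G ∈ ℝ^{p×K}`. -/
noncomputable def rowNorms {p K : ℕ} (G : Matrix (Fin p) (Fin K) ℝ) : Fin p → ℝ :=
  fun j => Real.sqrt (∑ k, G j k ^ 2)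

/-- The SLOPE penalty `P_λ(x) = Σ_j λ_j |x|_(j)`, where `|x|_(j)` is the `j`-th largest
component of `x` in magnitude. -/
noncomputable def slopePen {p : ℕ} (lam x : Fin p → ℝ) : ℝ :=
  ∑ j, lam j * |x (Tuple.sort (fun i => |x i|) j.rev)|

/-- Rearrangement: the SLOPE penalty dominates every permuted weighted sum. -/
lemma perm_sum_le_slopePen {p : ℕ} (lam x : Fin p → ℝ) (hmono : Antitone lam)
    (τ : Equiv.Perm (Fin p)) : ∑ j, lam j * |x (τ j)| ≤ slopePen lam x := by
  set σ : Equiv.Perm (Fin p) := Fin.revPerm.trans (Tuple.sort (fun i => |x i|)) with hσ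
  have hanti : Antitone (fun j => |x (σ j)|) := by
    intro a b hab
    exact Tuple.monotone_sort (fun i => |x i|) (Fin.rev_le_rev.mpr hab)
  have h := (hmono.monovary hanti).sum_mul_comp_perm_le_sum_mul (σ := τ.trans σ.symm)
  simpa [slopePen, hσ] using h

lemma rowNorms_eq {p K : ℕ} (G : Matrix (Fin p) (Fin K) ℝ) (j : Fin p) :
    rowNorms G j = ‖(WithLp.toLp 2 (G j) : EuclideanSpace ℝ (Fin K))‖ := by
  simp [rowNorms, EuclideanSpace.norm_eq]

lemma rowNorms_combo {p K : ℕ} (A B : Matrix (Fin p) (Fin K) ℝ) (a b : ℝ) (ha : 0 ≤ a)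
    (hb : 0 ≤ b) (j : Fin p) :
    |rowNorms (a • A + b • B) j| ≤ a * |rowNorms A j| + b * |rowNorms B j| := by
  simp only [rowNorms_eq, abs_norm]
  have h : (WithLp.toLp 2 ((a • A + b • B) j) : EuclideanSpace ℝ (Fin K))
      = a • WithLp.toLp 2 (A j) + b • WithLp.toLp 2 (B j) := rfl
  rw [h]
  refine (norm_add_le _ _).trans ?_
  rw [norm_smul, norm_smul, Real.norm_of_nonneg ha, Real.norm_of_nonneg hb]

/-- Convexity of the group SLOPE penalty: if `λ₁ ≥ λ₂ ≥ ⋯ ≥ λ_p ≥ 0`, then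
`G ↦ P_λ([[G]])` is convex on `ℝ^{p×K}`. -/
theorem groupSlope_convex {p K : ℕ} (lam : Fin p → ℝ)
    (hmono : Antitone lam) (hnonneg : ∀ j, 0 ≤ lam j) :
    ConvexOn ℝ Set.univ (fun G : Matrix (Fin p) (Fin K) ℝ => slopePen lam (rowNorms G)) := by
  refine ⟨convex_univ, ?_⟩
  intro A _ B _ a b ha hb _
  simp only [smul_eq_mul]
  set σ : Equiv.Perm (Fin p) :=
    Fin.revPerm.trans (Tuple.sort (fun i => |rowNorms (a • A + b • B) i|))
  have hA := mul_le_mul_of_nonneg_left (perm_sum_le_slopePen lam (rowNorms A) hmono σ) ha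
  have hB := mul_le_mul_of_nonneg_left (perm_sum_le_slopePen lam (rowNorms B) hmono σ) hb
  refine le_trans ?_ (add_le_add hA hB)
  rw [Finset.mul_sum, Finset.mul_sum, ← Finset.sum_add_distrib]
  refine Finset.sum_le_sum fun j _ => ?_
  have h := mul_le_mul_of_nonneg_left (rowNorms_combo A B a b ha hb (σ j)) (hnonneg j)
  refine h.trans (le_of_eq ?_)
  ring
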